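/- arXiv:1307.8240 — 6 statements merged into one kernel-verified Lean document; each statement's English description precedes it below -/
import Mathlib

section
/- Consider the finite-alphabet sparse signal model with K = 1 active variable, and the decoder that, given the observations (X, y), computes P(y | X_i) = ∏_{m=1}^{M} P(y_m | X_{m,i}) for every i ∈ {1,…,N}, sorts these values in descending order, and outputs as S_H the L indices with the smallest values. Then for every ρ ∈ [0,1], the average probability of error satisfies P_e ≤ exp[ −M ( E_0(ρ, 1, N−L) − (ρ/M)·log C(N−1, L−1) ) ], where C(a,b) denotes the binomial coefficient. -/
open Finset

noncomputable section

lemma aux_min (p z ρ : ℝ) (hp1 : p ≤ 1) (hpz : p ≤ z) (hz : 0 ≤ z) (h0 : 0 ≤ ρ) (h1 : ρ ≤ 1) :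
    p ≤ z ^ ρ := by
  rcases le_or_gt 1 z with h | h
  · exact hp1.trans (Real.one_le_rpow h h0)
  · rcases hz.eq_or_lt with h' | h'
    · subst h'
      exact hpz.trans (Real.rpow_nonneg le_rfl _)
    · calc p ≤ z := hpz
        _ = z ^ (1:ℝ) := (Real.rpow_one z).symm
        _ ≤ z ^ ρ := Real.rpow_le_rpow_of_exponent_ge h' h.le h1

open Classical in
lemma aux_single {A : Type} [Fintype A] (N L : ℕ) (hL : 1 ≤ L) (hLN : L ≤ N - 1)
    (Q : A → ℝ) (hQ0 : ∀ x, 0 ≤ Q x) (hQ1 : ∑ x, Q x = 1)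
    (w : A → ℝ) (hw : ∀ a, 0 ≤ w a)
    (φ : (Fin N → A) → Finset (Fin N))
    (hφcard : ∀ X, (φ X).card = L)
    (hφmin : ∀ X, ∀ i ∈ φ X, ∀ i' ∉ φ X, w (X i) ≤ w (X i'))
    (s : Fin N) (ρ : ℝ) (hρ0 : 0 ≤ ρ) (hρ1 : ρ ≤ 1) :
    ∑ X : Fin N → A, ((∏ i, Q (X i)) * w (X s)) * (if s ∈ φ X then 1 else 0)
      ≤ ((N - 1).choose (L - 1) : ℝ) ^ ρ *
        (∑ x, Q x * w x ^ (1 / (1 + ρ * ((N - L : ℕ) : ℝ)))) ^ (1 + ρ * ((N - L : ℕ) : ℝ)) := by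
  set n := N - L with hn
  set t : ℝ := 1 / (1 + ρ * (n : ℝ)) with ht
  have hden : 0 < 1 + ρ * (n : ℝ) := by positivity
  have htpos : 0 < t := by positivity
  set F := ∑ x, Q x * w x ^ t with hF
  have hF0 : 0 ≤ F := Finset.sum_nonneg fun x _ => mul_nonneg (hQ0 x) (Real.rpow_nonneg (hw x) _)
  set C : ℝ := ((N - 1).choose (L - 1) : ℝ) with hC
  have hC0 : 0 ≤ C := by positivity
  let p : A → ℝ := fun a => ∑ X : Fin N → A,
    (∏ i, Q (X i)) * ((if X s = a then 1 else 0) * (if s ∈ φ X then 1 else 0))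
  have hsplit : ∑ X : Fin N → A, ((∏ i, Q (X i)) * w (X s)) * (if s ∈ φ X then (1:ℝ) else 0)
      = ∑ a, p a * w a := by
    simp only [p, Finset.sum_mul]
    rw [Finset.sum_comm]
    refine Finset.sum_congr rfl fun X _ => ?_
    rw [Finset.sum_eq_single (X s)]
    · simp
    · intro b _ hb
      simp [hb.symm]
    · simp
  let q : A → ℝ := fun a => ∑ a', Q a' * (if w a ≤ w a' then 1 else 0)
  have hq0 : ∀ a, 0 ≤ q a := fun a => Finset.sum_nonneg fun x _ => by
    have := hQ0 x
    positivity
  have hprod0 : ∀ X : Fin N → A, 0 ≤ ∏ i, Q (X i) := fun X => Finset.prod_nonneg fun i _ => hQ0 _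
  have hp1 : ∀ a, p a ≤ Q a := by
    intro a
    have h1 : p a ≤ ∑ X : Fin N → A, ∏ i, (Q (X i) * if i = s then (if X i = a then 1 else 0) else 1) := by
      refine Finset.sum_le_sum fun X _ => ?_
      rw [Finset.prod_mul_distrib, Finset.prod_ite_eq' univ s]
      refine mul_le_mul_of_nonneg_left ?_ (hprod0 X)
      simp only [mem_univ, if_true]
      split_ifs <;> simp
    refine h1.trans (le_of_eq ?_)
    have := Finset.prod_univ_sum (fun _ : Fin N => (univ : Finset A))
      (fun i x => (Q x * if i = s then (if x = a then 1 else 0) else 1))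
    rw [Fintype.piFinset_univ] at this
    rw [← this, Finset.prod_eq_single s]
    · simp
    · intro i _ hi
      simp [hi, hQ1]
    · simp
  have hp2 : ∀ a, p a ≤ Q a * (C * q a ^ n) := by
    intro a
    have h1 : p a ≤ ∑ X : Fin N → A, ∑ T ∈ (univ.erase s).powersetCard n,
        ∏ i, (Q (X i) * ((if i = s then (if X i = a then 1 else 0) else 1) *
          (if i ∈ T then (if w a ≤ w (X i) then 1 else 0) else 1))) := by
      refine Finset.sum_le_sum fun X _ => ?_
      have hnn : ∀ T ∈ (univ.erase s).powersetCard n, 0 ≤ ∏ i, (Q (X i) * ((if i = s then (if X i = a then (1:ℝ) else 0) else 1) *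
          (if i ∈ T then (if w a ≤ w (X i) then 1 else 0) else 1))) := by
        intro T _
        refine Finset.prod_nonneg fun i _ => mul_nonneg (hQ0 _) (mul_nonneg ?_ ?_)
        · split_ifs <;> simp
        · split_ifs <;> simp
      by_cases hs : X s = a ∧ s ∈ φ X
      · have hmem : (φ X)ᶜ ∈ (univ.erase s).powersetCard n := by
          rw [Finset.mem_powersetCard]
          refine ⟨?_, ?_⟩
          · intro i hi
            rw [Finset.mem_compl] at hi
            simp only [mem_erase, mem_univ, and_true]
            rintro rfl
            exact hi hs.2
          · rw [Finset.card_compl, hφcard, Fintype.card_fin]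
        refine le_trans ?_ (Finset.single_le_sum hnn hmem)
        rw [if_pos hs.1, if_pos hs.2, one_mul, mul_one]
        refine le_of_eq (Finset.prod_congr rfl fun i _ => ?_)
        have e1 : (if i = s then (if X i = a then (1:ℝ) else 0) else 1) = 1 := by
          split_ifs with h1 h2
          · rfl
          · subst h1; exact absurd hs.1 h2
          · rfl
        have e2 : (if i ∈ (φ X)ᶜ then (if w a ≤ w (X i) then (1:ℝ) else 0) else 1) = 1 := by
          split_ifs with h1 h2
          · rfl
          · rw [Finset.mem_compl] at h1
            have := hφmin X s hs.2 i h1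
            rw [hs.1] at this
            exact absurd this h2
          · rfl
        rw [e1, e2]; ring
      · refine le_trans (le_of_eq ?_) (Finset.sum_nonneg hnn)
        by_cases h1 : X s = a
        · have : s ∉ φ X := fun h => hs ⟨h1, h⟩
          simp [this]
        · simp [h1]
    refine h1.trans (le_of_eq ?_)
    rw [Finset.sum_comm]
    have h2 : ∀ T ∈ (univ.erase s).powersetCard n, (∑ X : Fin N → A,
        ∏ i, (Q (X i) * ((if i = s then (if X i = a then 1 else 0) else 1) *
          (if i ∈ T then (if w a ≤ w (X i) then 1 else 0) else 1)))) = Q a * q a ^ n := by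
      intro T hT
      rw [Finset.mem_powersetCard] at hT
      have hsT : s ∉ T := fun h => by simpa using hT.1 h
      have := Finset.prod_univ_sum (fun _ : Fin N => (univ : Finset A))
        (fun i x => (Q x * ((if i = s then (if x = a then 1 else 0) else 1) *
          (if i ∈ T then (if w a ≤ w x then 1 else 0) else 1))))
      rw [Fintype.piFinset_univ] at this
      rw [← this]
      have h3 : ∀ i : Fin N, (∑ x, (Q x * ((if i = s then (if x = a then 1 else 0) else 1) *
          (if i ∈ T then (if w a ≤ w x then 1 else 0) else 1)))) =
          (if i = s then Q a else 1) * (if i ∈ T then q a else 1) := by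
        intro i
        by_cases hi : i = s
        · subst hi
          simp [hsT]
        · by_cases hiT : i ∈ T
          · simp only [hi, hiT, if_true, if_false, one_mul, q]
          · simp [hi, hiT, hQ1]
      rw [Finset.prod_congr rfl fun i _ => h3 i, Finset.prod_mul_distrib,
        Finset.prod_ite_eq' univ s, Finset.prod_ite_mem, Finset.univ_inter, Finset.prod_const, hT.2]
      simp
    rw [Finset.sum_congr rfl h2, Finset.sum_const, Finset.card_powersetCard, Finset.card_erase_of_mem (mem_univ _),
      Finset.card_univ, Fintype.card_fin, nsmul_eq_mul]
    have : (N - 1).choose n = (N - 1).choose (L - 1) := by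
      rw [← Nat.choose_symm (show n ≤ N - 1 by omega)]
      congr 1
      omega
    rw [this]; ring
  rw [hsplit]
  have key : ∀ a, p a * w a ≤ C ^ ρ * (F ^ (ρ * n) * (Q a * w a ^ t)) := by
    intro a
    rcases (hw a).eq_or_lt with h | h
    · rw [← h, mul_zero, Real.zero_rpow htpos.ne']
      simp
    have hwt : 0 < w a ^ t := Real.rpow_pos_of_pos h _
    have hq : q a ≤ F / w a ^ t := by
      rw [hF, Finset.sum_div]
      refine Finset.sum_le_sum fun x _ => ?_
      rw [mul_div_assoc]
      refine mul_le_mul_of_nonneg_left ?_ (hQ0 x)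
      split_ifs with hx
      · rw [one_le_div hwt]
        exact Real.rpow_le_rpow h.le hx htpos.le
      · exact div_nonneg (Real.rpow_nonneg (hw x) _) hwt.le
    have hpa : p a ≤ Q a * (C * q a ^ n) ^ ρ := by
      rcases (hQ0 a).eq_or_lt with h' | h'
      · have := hp1 a
        rw [← h'] at this ⊢
        simpa using this
      · rw [← div_le_iff₀' h']
        refine aux_min _ _ _ ?_ ?_ (mul_nonneg hC0 (pow_nonneg (hq0 a) _)) hρ0 hρ1
        · rw [div_le_one h']; exact hp1 a
        · rw [div_le_iff₀' h']; exact hp2 a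
    have hz : (C * q a ^ n) ^ ρ ≤ C ^ ρ * (F ^ (ρ * n) / (w a ^ t) ^ (ρ * n)) := by
      rw [Real.mul_rpow hC0 (pow_nonneg (hq0 a) _), ← Real.div_rpow hF0 hwt.le, ← Real.rpow_natCast,
        ← Real.rpow_mul (hq0 a), mul_comm (n:ℝ) ρ]
      refine mul_le_mul_of_nonneg_left ?_ (Real.rpow_nonneg hC0 _)
      exact Real.rpow_le_rpow (hq0 a) hq (by positivity)
    have hexp : w a / (w a ^ t) ^ (ρ * n) = w a ^ t := by
      rw [← Real.rpow_mul h.le]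
      nth_rewrite 1 [← Real.rpow_one (w a)]
      rw [← Real.rpow_sub h]
      congr 1
      rw [ht]; field_simp; ring
    calc p a * w a ≤ (Q a * (C ^ ρ * (F ^ (ρ * n) / (w a ^ t) ^ (ρ * n)))) * w a :=
          mul_le_mul_of_nonneg_right (hpa.trans (mul_le_mul_of_nonneg_left hz (hQ0 a))) h.le
      _ = C ^ ρ * (F ^ (ρ * n) * (Q a * (w a / (w a ^ t) ^ (ρ * n)))) := by ring
      _ = _ := by rw [hexp]
  refine (Finset.sum_le_sum fun a _ => key a).trans (le_of_eq ?_)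
  rw [← Finset.mul_sum, ← Finset.mul_sum, ← hF, Real.rpow_add_of_nonneg hF0 zero_le_one (by positivity),
    Real.rpow_one, mul_comm F]

/-- Finite-alphabet sparse signal model with `K = 1` active
variable, and the decoder that sorts the likelihoods `P(y | X_i)` in descending
order and outputs the `L` indices with the smallest values (formalized by the
property `hφmin`).  For every `ρ ∈ [0,1]`, the average probability of error
satisfies `P_e ≤ exp[−M(E₀(ρ,1,N−L) − (ρ/M)·log C(N−1, L−1))]`. -/
theorem stmt0 {𝓧 𝓨 : Type} [Fintype 𝓧] [Fintype 𝓨]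
    (N M L : ℕ) (hM : 0 < M) (hN : 1 ≤ N) (hL : 1 ≤ L) (hLN : L ≤ N - 1)
    (Q : 𝓧 → ℝ) (hQ0 : ∀ x, 0 ≤ Q x) (hQ1 : ∑ x, Q x = 1)
    (W : 𝓧 → 𝓨 → ℝ) (hW0 : ∀ x y, 0 ≤ W x y) (hW1 : ∀ x, ∑ y, W x y = 1)
    (φ : (Fin M → Fin N → 𝓧) → (Fin M → 𝓨) → Finset (Fin N))
    (hφcard : ∀ X y, (φ X y).card = L)
    (hφmin : ∀ X y, ∀ i ∈ φ X y, ∀ i' ∉ φ X y,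
      (∏ m, W (X m i) (y m)) ≤ ∏ m, W (X m i') (y m))
    (Pe : ℝ)
    (hPe : Pe = ((N : ℝ))⁻¹ *
      ∑ s : Fin N, ∑ X : Fin M → Fin N → 𝓧, ∑ y : Fin M → 𝓨,
        ((∏ m, ∏ i, Q (X m i)) * ∏ m, W (X m s) (y m)) *
          (if s ∈ φ X y then 1 else 0))
    (ρ : ℝ) (hρ0 : 0 ≤ ρ) (hρ1 : ρ ≤ 1)
    (E0 : ℝ)
    (hE0 : E0 = -Real.log (∑ y : 𝓨,
      (∑ x : 𝓧, Q x * W x y ^ (1 / (1 + ρ * ((N - L : ℕ) : ℝ)))) ^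
        (1 + ρ * ((N - L : ℕ) : ℝ)))) :
    Pe ≤ Real.exp (-(M : ℝ) *
      (E0 - ρ * Real.log ((N - 1).choose (L - 1) : ℝ) / (M : ℝ))) := by
  set r : ℝ := 1 + ρ * ((N - L : ℕ) : ℝ) with hr
  have hrpos : 0 < r := by positivity
  set G : 𝓨 → ℝ := fun y => ∑ x : 𝓧, Q x * W x y ^ (1 / r) with hG
  have hG0 : ∀ y, 0 ≤ G y := fun y =>
    Finset.sum_nonneg fun x _ => mul_nonneg (hQ0 x) (Real.rpow_nonneg (hW0 x y) _)
  set S : ℝ := ∑ y, G y ^ r with hS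
  set C : ℝ := ((N - 1).choose (L - 1) : ℝ) with hC
  have hCpos : 0 < C := by
    rw [hC]; exact_mod_cast Nat.choose_pos (by omega)
  have hSpos : 0 < S := by
    obtain ⟨x, -, hx⟩ : ∃ x ∈ (univ : Finset 𝓧), 0 < Q x :=
      Finset.exists_lt_of_sum_lt (by simp [hQ1])
    obtain ⟨y, -, hy⟩ : ∃ y ∈ (univ : Finset 𝓨), 0 < W x y :=
      Finset.exists_lt_of_sum_lt (by simp [hW1])
    refine Finset.sum_pos' (fun y _ => Real.rpow_nonneg (hG0 y) _) ⟨y, mem_univ _, ?_⟩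
    refine Real.rpow_pos_of_pos ?_ _
    exact Finset.sum_pos' (fun x _ => mul_nonneg (hQ0 x) (Real.rpow_nonneg (hW0 x y) _))
      ⟨x, mem_univ _, mul_pos hx (Real.rpow_pos_of_pos hy _)⟩
  have hrhs : Real.exp (-(M : ℝ) * (E0 - ρ * Real.log C / (M : ℝ))) = C ^ ρ * S ^ M := by
    have hM' : (M : ℝ) ≠ 0 := by positivity
    have : -(M : ℝ) * (E0 - ρ * Real.log C / (M : ℝ)) = Real.log C * ρ + (M : ℝ) * Real.log S := by
      rw [hE0]; field_simp; ring
    rw [this, Real.exp_add, ← Real.rpow_def_of_pos hCpos, Real.exp_nat_mul, Real.exp_log hSpos]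
  rw [hrhs, hPe]
  have hsumQ : ∑ x : Fin M → 𝓧, ∏ m, Q (x m) = 1 := by
    have := Finset.prod_univ_sum (fun _ : Fin M => (univ : Finset 𝓧)) (fun _ x => Q x)
    rw [Fintype.piFinset_univ] at this
    rw [← this]; simp [hQ1]
  have hs : ∀ s : Fin N, ∑ X : Fin M → Fin N → 𝓧, ∑ y : Fin M → 𝓨,
        ((∏ m, ∏ i, Q (X m i)) * ∏ m, W (X m s) (y m)) *
          (if s ∈ φ X y then (1:ℝ) else 0) ≤ C ^ ρ * S ^ M := by
    intro s
    rw [Finset.sum_comm]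
    have hy : ∀ y : Fin M → 𝓨, ∑ X : Fin M → Fin N → 𝓧,
        ((∏ m, ∏ i, Q (X m i)) * ∏ m, W (X m s) (y m)) *
          (if s ∈ φ X y then (1:ℝ) else 0) ≤ C ^ ρ * ∏ m, G (y m) ^ r := by
      intro y
      have h := aux_single (A := Fin M → 𝓧) N L hL hLN (fun x => ∏ m, Q (x m))
        (fun x => Finset.prod_nonneg fun m _ => hQ0 _) hsumQ
        (fun x => ∏ m, W (x m) (y m)) (fun x => Finset.prod_nonneg fun m _ => hW0 _ _)
        (fun X => φ (fun m i => X i m) y) (fun X => hφcard _ _)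
        (fun X i hi i' hi' => hφmin _ _ i hi i' hi') s ρ hρ0 hρ1
      have e1 : ∑ X : Fin M → Fin N → 𝓧,
        ((∏ m, ∏ i, Q (X m i)) * ∏ m, W (X m s) (y m)) *
          (if s ∈ φ X y then (1:ℝ) else 0) = ∑ X : Fin N → Fin M → 𝓧,
          ((∏ i, ∏ m, Q (X i m)) * ∏ m, W (X s m) (y m)) *
          (if s ∈ φ (fun m i => X i m) y then (1:ℝ) else 0) := by
        refine Fintype.sum_equiv (Equiv.piComm _) _ _ fun X => ?_
        rw [Finset.prod_comm]
        simp only [Equiv.piComm_apply, Function.swap]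
      have e2 : ∑ x : Fin M → 𝓧, (∏ m, Q (x m)) * (∏ m, W (x m) (y m)) ^ (1 / r)
          = ∏ m, G (y m) := by
        have := Finset.prod_univ_sum (fun _ : Fin M => (univ : Finset 𝓧))
          (fun m x => Q x * W x (y m) ^ (1 / r))
        rw [Fintype.piFinset_univ] at this
        rw [hG]
        simp only
        rw [this]
        refine Finset.sum_congr rfl fun x _ => ?_
        rw [Finset.prod_mul_distrib, Real.finsetProd_rpow _ _ (fun m _ => hW0 _ _)]
      rw [e1]
      refine le_trans (le_of_eq ?_) (h.trans (le_of_eq ?_))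
      · refine Finset.sum_congr rfl fun X _ => ?_
        congr
      · rw [← hr, e2, ← Real.finsetProd_rpow _ _ (fun m _ => hG0 _)]
    refine (Finset.sum_le_sum fun y _ => hy y).trans (le_of_eq ?_)
    rw [← Finset.mul_sum]
    have := Finset.prod_univ_sum (fun _ : Fin M => (univ : Finset 𝓨)) (fun _ y => G y ^ r)
    rw [Fintype.piFinset_univ] at this
    rw [← this]
    simp [hS]
  have hN' : (0 : ℝ) < N := by exact_mod_cast hN
  rw [inv_mul_le_iff₀ hN']
  refine (Finset.sum_le_sum fun s _ => hs s).trans (le_of_eq ?_)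
  simp

end
end

section
/- Consider the finite-alphabet sparse signal model. For any decoder φ mapping the observations to an L-element subset of {1,…,N}, with average probability of error P_e (error means the output set intersects the active set), the following Fano-type lower bound holds for every j ∈ {1,…,K}: P_e ≥ 1 − ( H_b(P_e) + M·I^(j) ) / Γ_l(L,N,K,j), where Γ_l(L,N,K,j) = log[ C(N−K+j, j) / C(N−K+j−L, j) ] and H_b(p) = −p log p − (1−p) log(1−p). -/
open Finset

noncomputable section

/-- Probability of the input matrix `X` under i.i.d. `Q`-distributed entries. -/
def inputProb {𝓧 : Type} (N M : ℕ) (Q : 𝓧 → ℝ) (X : Fin M → Fin N → 𝓧) : ℝ :=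
  ∏ m, ∏ i, Q (X m i)

/-- Likelihood `P(y | X_A)` of the observations `y` given the columns of `X`
indexed by a `K`-element set `A` (the symmetric kernel `W` is evaluated on the
columns of `A` in increasing order; `0` for sets of the wrong size). -/
def lik {𝓧 𝓨 : Type} (N M K : ℕ) (W : (Fin K → 𝓧) → 𝓨 → ℝ)
    (X : Fin M → Fin N → 𝓧) (y : Fin M → 𝓨) (A : Finset (Fin N)) : ℝ :=
  if h : A.card = K then
    ∏ m, W (fun k => X m ((A.orderIsoOfFin h k : Fin N))) (y m)
  else 0

/-- `P(Y, X_{S^{(K−j)}} | X_{S^{(j)}})`, for the partition of the `K` active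
variables into a block of `j` and the remaining `K − j`. -/
def condJ {𝓧 𝓨 : Type} (K j : ℕ) (hj : j ≤ K) (Q : 𝓧 → ℝ)
    (W : (Fin K → 𝓧) → 𝓨 → ℝ) (xs : Fin j → 𝓧) (xr : Fin (K - j) → 𝓧)
    (y : 𝓨) : ℝ :=
  (∏ k, Q (xr k)) *
    W (fun k => (Fin.append xs xr : Fin (j + (K - j)) → 𝓧)
      (Fin.cast (Nat.add_sub_cancel' hj).symm k)) y

/-- The mutual information `I^{(j)}` between `(Y, X_{S^{(K−j)}})` and
`X_{S^{(j)}}`. -/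
def MIj {𝓧 𝓨 : Type} [Fintype 𝓧] [Fintype 𝓨] (K j : ℕ) (hj : j ≤ K)
    (Q : 𝓧 → ℝ) (W : (Fin K → 𝓧) → 𝓨 → ℝ) : ℝ :=
  ∑ y : 𝓨, ∑ xr : Fin (K - j) → 𝓧, ∑ xs : Fin j → 𝓧,
    condJ K j hj Q W xs xr y * (∏ k, Q (xs k)) *
      Real.log (condJ K j hj Q W xs xr y /
        ∑ xs' : Fin j → 𝓧, (∏ k, Q (xs' k)) * condJ K j hj Q W xs' xr y)


lemma klPoint (a b c : ℝ) (ha : 0 ≤ a) (hb : 0 ≤ b) (hc : 0 ≤ c) (hab : b = 0 → a = 0)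
    (hca : c = 0 → a = 0) : a * Real.log c + a - c * b ≤ a * Real.log (a / b) := by
  rcases ha.eq_or_lt with h | ha
  · subst h
    have := mul_nonneg hc hb
    simp only [zero_mul]; linarith
  have hb' : 0 < b := hb.lt_of_ne (fun h => ha.ne' (hab h.symm))
  have hc' : 0 < c := hc.lt_of_ne (fun h => ha.ne' (hca h.symm))
  have h1 := Real.one_sub_inv_le_log_of_pos (x := a / b / c) (by positivity)
  rw [Real.log_div (by positivity) (by positivity)] at h1
  have h2 := mul_le_mul_of_nonneg_left h1 ha.le
  have h3 : a * (1 - (a / b / c)⁻¹) = a - c * b := by field_simp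
  rw [h3] at h2
  linarith

lemma fanoAbs {τ : Type*} (Ω : Finset τ) (P R : τ → ℝ) (E : τ → Prop) [DecidablePred E]
    (hP : ∀ i ∈ Ω, 0 ≤ P i) (hR : ∀ i ∈ Ω, 0 ≤ R i) (hPR : ∀ i ∈ Ω, R i = 0 → P i = 0)
    (hP1 : ∑ i ∈ Ω, P i = 1) (hR1 : ∑ i ∈ Ω, R i = 1) (p G : ℝ) (hG : 0 < G)
    (hp : ∑ i ∈ Ω with E i, P i = p) (hRE : G * ∑ i ∈ Ω with E i, R i ≤ 1) :
    p * Real.log p + (1 - p) * Real.log (1 - p) + p * Real.log G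
      ≤ ∑ i ∈ Ω, P i * Real.log (P i / R i) := by
  have hsP := Finset.sum_filter_add_sum_filter_not Ω E P
  have hsR := Finset.sum_filter_add_sum_filter_not Ω E R
  have hs := Finset.sum_filter_add_sum_filter_not Ω E (fun i => P i * Real.log (P i / R i))
  have hp0 : 0 ≤ p := hp ▸ Finset.sum_nonneg (fun i hi => hP i (Finset.mem_filter.1 hi).1)
  have hq : ∑ i ∈ Ω with ¬ E i, P i = 1 - p := by linarith
  have hq0 : 0 ≤ 1 - p := hq ▸ Finset.sum_nonneg (fun i hi => hP i (Finset.mem_filter.1 hi).1)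
  have hRE0 : 0 ≤ ∑ i ∈ Ω with E i, R i :=
    Finset.sum_nonneg (fun i hi => hR i (Finset.mem_filter.1 hi).1)
  have key : ∀ (F : Finset τ), F ⊆ Ω → ∀ c : ℝ, 0 ≤ c → (c = 0 → ∑ i ∈ F, P i = 0) →
      (∑ i ∈ F, P i) * Real.log c + (∑ i ∈ F, P i) - c * (∑ i ∈ F, R i)
        ≤ ∑ i ∈ F, P i * Real.log (P i / R i) := by
    intro F hF c hc hc0
    rw [Finset.sum_mul, Finset.mul_sum, ← Finset.sum_add_distrib, ← Finset.sum_sub_distrib]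
    refine Finset.sum_le_sum fun i hi => klPoint _ _ _ (hP i (hF hi)) (hR i (hF hi)) hc
      (hPR i (hF hi)) (fun h => ?_)
    exact (Finset.sum_eq_zero_iff_of_nonneg (fun i hi => hP i (hF hi))).1 (hc0 h) i hi
  have k1 := key _ (Finset.filter_subset E Ω) (p * G) (by positivity) (fun h => by
    rcases mul_eq_zero.1 h with h | h
    · rw [hp, h]
    · exact absurd h hG.ne')
  have k2 := key _ (Finset.filter_subset (fun i => ¬ E i) Ω) (1 - p) hq0 (fun h => by rw [hq, h])
  rw [hp] at k1
  rw [hq] at k2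
  have e1 : p * Real.log (p * G) = p * Real.log p + p * Real.log G := by
    rcases eq_or_ne p 0 with h | h
    · simp [h]
    · rw [Real.log_mul h hG.ne']; ring
  have e2 : p * G * ∑ i ∈ Ω with E i, R i ≤ p := by
    rw [mul_assoc]; exact mul_le_of_le_one_right hp0 hRE
  have e3 : (1 - p) * ∑ i ∈ Ω with ¬ E i, R i ≤ 1 - p :=
    mul_le_of_le_one_right hq0 (by linarith)
  linarith

lemma sumProdOne {ι α : Type*} [Fintype ι] [DecidableEq ι] [Fintype α] (p : α → ℝ)
    (hp : ∑ a, p a = 1) : ∑ z : ι → α, ∏ m, p (z m) = 1 := by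
  have := Finset.prod_univ_sum (fun _ : ι => (Finset.univ : Finset α)) (fun _ a => p a)
  simp only [hp, Finset.prod_const_one, Fintype.piFinset_univ] at this
  exact this.symm

lemma sumProdSum {M : ℕ} {α : Type*} [Fintype α] (p g : α → ℝ)
    (hp : ∑ a, p a = 1) :
    ∑ z : Fin M → α, (∏ m, p (z m)) * ∑ m, g (z m) = M * ∑ a, p a * g a := by
  classical
  have h : ∀ m0 : Fin M, ∑ z : Fin M → α, (∏ m, p (z m)) * g (z m0) = ∑ a, p a * g a := by
    intro m0
    have := Finset.prod_univ_sum (fun _ : Fin M => (Finset.univ : Finset α))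
      (fun m a => p a * if m = m0 then g a else 1)
    simp only [Fintype.piFinset_univ, Finset.prod_mul_distrib, Finset.prod_ite_eq',
      Finset.mem_univ, if_true] at this
    rw [← this, Finset.prod_eq_single m0]
    · simp
    · intro b _ hb; simp [hb, hp]
    · simp
  simp_rw [Finset.mul_sum]
  rw [Finset.sum_comm]
  simp_rw [h]
  simp [Finset.mul_sum]

lemma marginal {ι κ 𝓧 : Type*} [Fintype ι] [Fintype κ] [DecidableEq ι] [DecidableEq κ]
    [Fintype 𝓧] (Q : 𝓧 → ℝ)
    (hQ : ∑ a, Q a = 1) (e : κ → ι) (he : Function.Injective e) (h : (κ → 𝓧) → ℝ) :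
    ∑ x : ι → 𝓧, (∏ i, Q (x i)) * h (x ∘ e) = ∑ u : κ → 𝓧, (∏ k, Q (u k)) * h u := by
  classical
  let E : κ ⊕ {i // i ∉ Set.range e} ≃ ι :=
    (Equiv.sumCongr (Equiv.ofInjective e he) (Equiv.refl _)).trans
      (Equiv.Set.sumCompl (Set.range e))
  have hE : ∀ k, E (Sum.inl k) = e k := fun k => by simp [E]; rfl
  rw [← ((Equiv.sumArrowEquivProdArrow _ _ 𝓧).symm.trans (Equiv.arrowCongr E (Equiv.refl _))).sum_comp,
    Fintype.sum_prod_type]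
  refine Finset.sum_congr rfl fun u _ => ?_
  have h1 : ∀ v : {i // i ∉ Set.range e} → 𝓧,
      (((Equiv.sumArrowEquivProdArrow _ _ 𝓧).symm.trans
        (Equiv.arrowCongr E (Equiv.refl _))) (u, v)) ∘ e = u := by
    intro v; funext k
    simp [Equiv.arrowCongr, ← hE]
  have h2 : ∀ v : {i // i ∉ Set.range e} → 𝓧,
      ∏ i, Q ((((Equiv.sumArrowEquivProdArrow _ _ 𝓧).symm.trans
        (Equiv.arrowCongr E (Equiv.refl _))) (u, v)) i) = (∏ k, Q (u k)) * ∏ i, Q (v i) := by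
    intro v
    rw [← E.prod_comp, Fintype.prod_sum_type]
    simp [Equiv.arrowCongr]
  simp_rw [h1, h2]
  rw [← Finset.sum_mul, ← Finset.mul_sum, sumProdOne Q hQ, mul_one]

lemma marginal2 {ι κ₁ κ₂ 𝓧 : Type*} [Fintype ι] [Fintype κ₁] [DecidableEq ι] [DecidableEq κ₁]
    [Fintype κ₂] [DecidableEq κ₂]
    [Fintype 𝓧] (Q : 𝓧 → ℝ) (hQ : ∑ a, Q a = 1) (a : κ₁ → ι) (t : κ₂ → ι)
    (he : Function.Injective (Sum.elim a t)) (h : (κ₁ → 𝓧) → (κ₂ → 𝓧) → ℝ) :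
    ∑ x : ι → 𝓧, (∏ i, Q (x i)) * h (x ∘ a) (x ∘ t) =
      ∑ u : κ₁ → 𝓧, ∑ v : κ₂ → 𝓧, (∏ k, Q (u k)) * (∏ k, Q (v k)) * h u v := by
  have := marginal Q hQ (Sum.elim a t) he (fun w => h (w ∘ Sum.inl) (w ∘ Sum.inr))
  have h0 : ∀ x : ι → 𝓧, h (x ∘ a) (x ∘ t) =
    h ((x ∘ Sum.elim a t) ∘ Sum.inl) ((x ∘ Sum.elim a t) ∘ Sum.inr) := fun x => rfl
  simp_rw [h0]
  rw [this, ← (Equiv.sumArrowEquivProdArrow _ _ 𝓧).symm.sum_comp, Fintype.sum_prod_type]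
  refine Finset.sum_congr rfl fun u _ => Finset.sum_congr rfl fun v _ => ?_
  rw [Fintype.prod_sum_type]
  rfl

lemma likEq {𝓧 𝓨 : Type} (N M K : ℕ) (W : (Fin K → 𝓧) → 𝓨 → ℝ)
    (hWsym : ∀ (xs : Fin K → 𝓧) (σ : Equiv.Perm (Fin K)), W (xs ∘ σ) = W xs)
    (X : Fin M → Fin N → 𝓧) (y : Fin M → 𝓨) (A : Finset (Fin N)) (hA : A.card = K)
    (e : Fin K → Fin N) (he : Function.Injective e) (hr : ∀ k, e k ∈ A) :
    lik N M K W X y A = ∏ m, W (X m ∘ e) (y m) := by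
  unfold lik
  rw [dif_pos hA]
  refine Finset.prod_congr rfl fun m _ => ?_
  let f : Fin K → Fin K := fun k => (A.orderIsoOfFin hA).symm ⟨e k, hr k⟩
  have hf : Function.Injective f := fun a b hab => he (by simpa [f] using hab)
  let σ : Equiv.Perm (Fin K) := Equiv.ofBijective f (Finite.injective_iff_bijective.1 hf)
  rw [← hWsym _ σ]
  have : (fun k => X m ((A.orderIsoOfFin hA k : Fin N))) ∘ σ = X m ∘ e := by
    funext k
    have h1 : A.orderIsoOfFin hA (σ k) = ⟨e k, hr k⟩ :=
      (A.orderIsoOfFin hA).apply_symm_apply _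
    simp only [Function.comp_apply, h1]
  rw [this]

lemma sumPairs {N K j : ℕ} (hj : j ≤ K) (f : Finset (Fin N) → ℝ) :
    ∑ q ∈ (Finset.powersetCard (K - j) (Finset.univ : Finset (Fin N))).sigma
      (fun T => Finset.powersetCard j Tᶜ), f (q.1 ∪ q.2) =
    K.choose j * ∑ S ∈ Finset.powersetCard K (Finset.univ : Finset (Fin N)), f S := by
  classical
  have hmap : ∀ q ∈ (Finset.powersetCard (K - j) (Finset.univ : Finset (Fin N))).sigma
      (fun T => Finset.powersetCard j Tᶜ),
      q.1 ∪ q.2 ∈ Finset.powersetCard K (Finset.univ : Finset (Fin N)) := by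
    rintro ⟨T, A⟩ hq
    simp only [Finset.mem_sigma, Finset.mem_powersetCard, Finset.subset_univ, true_and] at hq ⊢
    rw [Finset.card_union_of_disjoint, hq.1, hq.2.2]
    · omega
    · exact (Finset.subset_compl_iff_disjoint_left.1 hq.2.1)
  rw [← Finset.sum_fiberwise_of_maps_to hmap, Finset.mul_sum]
  refine Finset.sum_congr rfl fun S hS => ?_
  rw [Finset.sum_congr rfl (g := fun _ => f S)
    (fun q hq => by rw [(Finset.mem_filter.1 hq).2])]
  rw [Finset.sum_const, nsmul_eq_mul]
  congr 2
  have hSc : S.card = K := (Finset.mem_powersetCard.1 hS).2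
  rw [← hSc, ← Finset.card_powersetCard]
  refine Finset.card_bij' (fun q _ => q.2) (fun A _ => ⟨S \ A, A⟩) ?_ ?_ ?_ ?_
  · rintro ⟨T, A⟩ hq
    simp only [Finset.mem_filter, Finset.mem_sigma, Finset.mem_powersetCard] at hq ⊢
    exact ⟨hq.2 ▸ Finset.subset_union_right, hq.1.2.2⟩
  · intro A hA
    simp only [Finset.mem_filter, Finset.mem_sigma, Finset.mem_powersetCard,
      Finset.subset_univ, true_and] at hA ⊢
    refine ⟨⟨?_, ?_, hA.2⟩, Finset.sdiff_union_of_subset hA.1⟩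
    · rw [Finset.card_sdiff_of_subset hA.1, hA.2]
    · intro x hx; simp [hx]
  · rintro ⟨T, A⟩ hq
    simp only [Finset.mem_filter, Finset.mem_sigma, Finset.mem_powersetCard] at hq ⊢
    have hd := Finset.subset_compl_iff_disjoint_left.1 hq.1.2.1
    have : S \ A = T := by
      rw [← hq.2]; exact Finset.union_sdiff_cancel_right hd
    rw [this]
  · intro A hA; rfl

lemma existsEnum {N : ℕ} (hN : 0 < N) (k : ℕ) : ∃ en : Finset (Fin N) → Fin k → Fin N,
    ∀ T, T.card = k → Function.Injective (en T) ∧ ∀ i, en T i ∈ T := by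
  classical
  have : ∀ T : Finset (Fin N), ∃ f : Fin k → Fin N, T.card = k →
      Function.Injective f ∧ ∀ i, f i ∈ T := by
    intro T
    by_cases h : T.card = k
    · exact ⟨T.orderEmbOfFin h, fun _ => ⟨(T.orderEmbOfFin h).injective,
        fun i => T.orderEmbOfFin_mem h i⟩⟩
    · exact ⟨fun _ => ⟨0, hN⟩, fun h' => absurd h' h⟩
  choose f hf using this
  exact ⟨f, hf⟩


/-- Kernel with split arguments. -/
def splitW {𝓧 𝓨 : Type} (K j : ℕ) (hj : j ≤ K)
    (W : (Fin K → 𝓧) → 𝓨 → ℝ) (xs : Fin j → 𝓧) (xr : Fin (K - j) → 𝓧) (y : 𝓨) : ℝ :=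
  W (fun k => (Fin.append xs xr : Fin (j + (K - j)) → 𝓧)
      (Fin.cast (Nat.add_sub_cancel' hj).symm k)) y

/-- Output law given the revealed block. -/
def barW {𝓧 𝓨 : Type} [Fintype 𝓧] (K j : ℕ) (hj : j ≤ K) (Q : 𝓧 → ℝ)
    (W : (Fin K → 𝓧) → 𝓨 → ℝ) (xr : Fin (K - j) → 𝓧) (y : 𝓨) : ℝ :=
  ∑ xs : Fin j → 𝓧, (∏ k, Q (xs k)) * splitW K j hj W xs xr y

/-- Single letter true law. -/
def pS {𝓧 𝓨 : Type} {N : ℕ} (K j : ℕ) (hj : j ≤ K) (Q : 𝓧 → ℝ)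
    (W : (Fin K → 𝓧) → 𝓨 → ℝ) (a : Fin j → Fin N) (t : Fin (K - j) → Fin N)
    (z : (Fin N → 𝓧) × 𝓨) : ℝ :=
  (∏ i, Q (z.1 i)) * splitW K j hj W (z.1 ∘ a) (z.1 ∘ t) z.2

/-- Single letter reference law. -/
def rS {𝓧 𝓨 : Type} [Fintype 𝓧] {N : ℕ} (K j : ℕ) (hj : j ≤ K) (Q : 𝓧 → ℝ)
    (W : (Fin K → 𝓧) → 𝓨 → ℝ) (t : Fin (K - j) → Fin N)
    (z : (Fin N → 𝓧) × 𝓨) : ℝ :=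
  (∏ i, Q (z.1 i)) * barW K j hj Q W (z.1 ∘ t) z.2

lemma mulLogCancel (q V B : ℝ) : q * V * Real.log (q * V / (q * B)) =
    q * (V * Real.log (V / B)) := by
  rcases eq_or_ne q 0 with h | h
  · simp [h]
  · rw [mul_div_mul_left _ _ h]; ring

lemma pS_nonneg {𝓧 𝓨 : Type} [Fintype 𝓧] [Fintype 𝓨] {N : ℕ} (K j : ℕ) (hj : j ≤ K) (Q : 𝓧 → ℝ)
    (hQ0 : ∀ x, 0 ≤ Q x) (W : (Fin K → 𝓧) → 𝓨 → ℝ) (hW0 : ∀ xs y, 0 ≤ W xs y) (a : Fin j → Fin N) (t : Fin (K - j) → Fin N)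
    (z : (Fin N → 𝓧) × 𝓨) : 0 ≤ pS K j hj Q W a t z :=
  mul_nonneg (Finset.prod_nonneg fun _ _ => hQ0 _) (hW0 _ _)

lemma rS_nonneg {𝓧 𝓨 : Type} [Fintype 𝓧] [Fintype 𝓨] {N : ℕ} (K j : ℕ) (hj : j ≤ K) (Q : 𝓧 → ℝ)
    (hQ0 : ∀ x, 0 ≤ Q x) (W : (Fin K → 𝓧) → 𝓨 → ℝ) (hW0 : ∀ xs y, 0 ≤ W xs y) (t : Fin (K - j) → Fin N)
    (z : (Fin N → 𝓧) × 𝓨) : 0 ≤ rS K j hj Q W t z :=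
  mul_nonneg (Finset.prod_nonneg fun _ _ => hQ0 _)
    (Finset.sum_nonneg fun _ _ => mul_nonneg (Finset.prod_nonneg fun _ _ => hQ0 _) (hW0 _ _))

lemma pS_ac {𝓧 𝓨 : Type} [Fintype 𝓧] [Fintype 𝓨] {N : ℕ} (K j : ℕ) (hj : j ≤ K) (Q : 𝓧 → ℝ)
    (hQ0 : ∀ x, 0 ≤ Q x) (W : (Fin K → 𝓧) → 𝓨 → ℝ) (hW0 : ∀ xs y, 0 ≤ W xs y) (a : Fin j → Fin N) (t : Fin (K - j) → Fin N)
    (z : (Fin N → 𝓧) × 𝓨) (h : rS K j hj Q W t z = 0) : pS K j hj Q W a t z = 0 := by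
  unfold rS at h
  unfold pS
  rcases mul_eq_zero.1 h with h | h
  · rw [h, zero_mul]
  by_cases hq : ∏ i, Q (z.1 i) = 0
  · rw [hq, zero_mul]
  unfold barW at h
  have h2 := (Finset.sum_eq_zero_iff_of_nonneg (fun _ _ =>
    mul_nonneg (Finset.prod_nonneg fun _ _ => hQ0 _) (hW0 _ _))).1 h (z.1 ∘ a) (Finset.mem_univ _)
  rcases mul_eq_zero.1 h2 with h3 | h3
  · exfalso
    obtain ⟨k, _, hk⟩ := Finset.prod_eq_zero_iff.1 h3
    exact hq (Finset.prod_eq_zero (Finset.mem_univ (a k)) hk)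
  · exact mul_eq_zero_of_right _ h3

lemma pS_sum {𝓧 𝓨 : Type} [Fintype 𝓧] [Fintype 𝓨] {N : ℕ} (K j : ℕ) (hj : j ≤ K) (Q : 𝓧 → ℝ)
    (hQ1 : ∑ x, Q x = 1) (W : (Fin K → 𝓧) → 𝓨 → ℝ) (hW1 : ∀ xs, ∑ y, W xs y = 1) (a : Fin j → Fin N) (t : Fin (K - j) → Fin N)
    : ∑ z, pS K j hj Q W a t z = 1 := by
  rw [Fintype.sum_prod_type]
  simp only [pS, splitW, ← Finset.mul_sum, hW1, mul_one]
  exact sumProdOne Q hQ1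

lemma rS_sum {𝓧 𝓨 : Type} [Fintype 𝓧] [Fintype 𝓨] {N : ℕ} (K j : ℕ) (hj : j ≤ K) (Q : 𝓧 → ℝ)
    (hQ1 : ∑ x, Q x = 1) (W : (Fin K → 𝓧) → 𝓨 → ℝ) (hW1 : ∀ xs, ∑ y, W xs y = 1) (t : Fin (K - j) → Fin N)
    : ∑ z, rS K j hj Q W t z = 1 := by
  rw [Fintype.sum_prod_type]
  have : ∀ xr : Fin (K - j) → 𝓧, ∑ y, barW K j hj Q W xr y = 1 := by
    intro xr
    unfold barW
    rw [Finset.sum_comm]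
    simp only [splitW, ← Finset.mul_sum, hW1, mul_one]
    exact sumProdOne Q hQ1
  simp only [rS, ← Finset.mul_sum, this, mul_one]
  exact sumProdOne Q hQ1

lemma single_kl {𝓧 𝓨 : Type} [Fintype 𝓧] [Fintype 𝓨] {N : ℕ} (K j : ℕ) (hj : j ≤ K) (Q : 𝓧 → ℝ)
    (hQ1 : ∑ x, Q x = 1) (W : (Fin K → 𝓧) → 𝓨 → ℝ) (a : Fin j → Fin N) (t : Fin (K - j) → Fin N)
    (he : Function.Injective (Sum.elim a t)) :
    ∑ z, pS K j hj Q W a t z * Real.log (pS K j hj Q W a t z / rS K j hj Q W t z)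
      = MIj K j hj Q W := by
  unfold pS rS MIj
  simp_rw [mulLogCancel]
  rw [Fintype.sum_prod_type]
  simp_rw [← Finset.mul_sum]
  rw [marginal2 Q hQ1 a t he (fun xs xr => ∑ y, splitW K j hj W xs xr y *
    Real.log (splitW K j hj W xs xr y / barW K j hj Q W xr y))]
  simp_rw [Finset.mul_sum]
  rw [Finset.sum_comm]
  rw [Finset.sum_congr rfl fun xr _ => Finset.sum_comm]
  rw [Finset.sum_comm]
  refine Finset.sum_congr rfl fun y _ => Finset.sum_congr rfl fun xr _ =>
    Finset.sum_congr rfl fun xs _ => ?_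
  have hc : ∀ xs, condJ K j hj Q W xs xr y = (∏ k, Q (xr k)) * splitW K j hj W xs xr y :=
    fun _ => rfl
  have hb : ∑ xs' : Fin j → 𝓧, (∏ k, Q (xs' k)) * condJ K j hj Q W xs' xr y =
      (∏ k, Q (xr k)) * barW K j hj Q W xr y := by
    unfold barW
    rw [Finset.mul_sum]
    refine Finset.sum_congr rfl fun xs' _ => ?_
    rw [hc]; ring
  rw [hb, hc, mul_right_comm, mul_right_comm, mul_right_comm _ (∏ k, Q (xs k)), mulLogCancel]
  ring

lemma multi_kl {𝓧 𝓨 : Type} [Fintype 𝓧] [Fintype 𝓨] {N : ℕ} (K j : ℕ) (hj : j ≤ K) (Q : 𝓧 → ℝ)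
    (hQ0 : ∀ x, 0 ≤ Q x) (hQ1 : ∑ x, Q x = 1) (W : (Fin K → 𝓧) → 𝓨 → ℝ) (hW0 : ∀ xs y, 0 ≤ W xs y) (hW1 : ∀ xs, ∑ y, W xs y = 1) (a : Fin j → Fin N) (t : Fin (K - j) → Fin N)
    (M : ℕ) (he : Function.Injective (Sum.elim a t)) :
    ∑ z : Fin M → (Fin N → 𝓧) × 𝓨, (∏ m, pS K j hj Q W a t (z m)) *
      Real.log ((∏ m, pS K j hj Q W a t (z m)) / ∏ m, rS K j hj Q W t (z m))
      = M * MIj K j hj Q W := by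
  rw [← single_kl K j hj Q hQ1 W a t he, ← sumProdSum _ _ (pS_sum K j hj Q hQ1 W hW1 a t)]
  refine Finset.sum_congr rfl fun z _ => ?_
  by_cases h : ∏ m, pS K j hj Q W a t (z m) = 0
  · simp [h]
  rw [← Finset.prod_div_distrib, Real.log_prod]
  intro m _ h0
  have hp := Finset.prod_ne_zero_iff.1 h m (Finset.mem_univ m)
  rcases div_eq_zero_iff.1 h0 with h1 | h1
  · exact hp h1
  · exact hp (pS_ac K j hj Q hQ0 W hW0 a t _ h1)

lemma chooseLt (n L j : ℕ) (hL : 1 ≤ L) (hj : 1 ≤ j) (h : L + j ≤ n) :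
    (n - L).choose j < n.choose j := by
  obtain ⟨n, rfl⟩ : ∃ m, n = m + 1 := ⟨n - 1, by omega⟩
  obtain ⟨j, rfl⟩ : ∃ m, j = m + 1 := ⟨j - 1, by omega⟩
  rw [Nat.choose_succ_succ']
  have h1 : (n + 1 - L).choose (j + 1) ≤ n.choose (j + 1) := Nat.choose_le_choose _ (by omega)
  have h2 : 0 < n.choose j := Nat.choose_pos (by omega)
  omega

lemma prod_pS {𝓧 𝓨 : Type} (N M K j : ℕ) (hj : j ≤ K) (Q : 𝓧 → ℝ)
    (W : (Fin K → 𝓧) → 𝓨 → ℝ)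
    (hWsym : ∀ (xs : Fin K → 𝓧) (σ : Equiv.Perm (Fin K)), W (xs ∘ σ) = W xs)
    (a : Fin j → Fin N) (t : Fin (K - j) → Fin N)
    (T A : Finset (Fin N)) (hT : T.card = K - j) (hA : A.card = j) (hTA : Disjoint T A)
    (he : Function.Injective (Sum.elim a t)) (ha : ∀ k, a k ∈ A) (ht : ∀ k, t k ∈ T)
    (z : Fin M → (Fin N → 𝓧) × 𝓨) :
    inputProb N M Q (fun m => (z m).1) *
      lik N M K W (fun m => (z m).1) (fun m => (z m).2) (T ∪ A) =
      ∏ m, pS K j hj Q W a t (z m) := by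
  let e : Fin K → Fin N := fun k => (Fin.append a t : Fin (j + (K - j)) → Fin N)
      (Fin.cast (Nat.add_sub_cancel' hj).symm k)
  have hcard : (T ∪ A).card = K := by
    rw [Finset.card_union_of_disjoint hTA, hT, hA]; omega
  have happ : Function.Injective (Fin.append a t) := by
    rw [← finSumFinEquiv.injective_comp]
    convert he using 1
    funext k
    rcases k with k | k <;> simp
  have heinj : Function.Injective e := happ.comp (Fin.cast_injective _)
  have hmem : ∀ k, e k ∈ T ∪ A := by
    intro k
    have : ∀ l : Fin (j + (K - j)), Fin.append a t l ∈ T ∪ A := by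
      intro l
      refine Fin.addCases (fun i => ?_) (fun i => ?_) l
      · rw [Fin.append_left]; exact Finset.mem_union_right _ (ha i)
      · rw [Fin.append_right]; exact Finset.mem_union_left _ (ht i)
    exact this _
  rw [likEq N M K W hWsym _ _ _ hcard e heinj hmem]
  unfold inputProb pS splitW
  rw [← Finset.prod_mul_distrib]
  refine Finset.prod_congr rfl fun m _ => ?_
  congr 2
  funext k
  have : ∀ l : Fin (j + (K - j)), (z m).1 (Fin.append a t l) =
      Fin.append ((z m).1 ∘ a) ((z m).1 ∘ t) l := by
    intro l
    refine Fin.addCases (fun i => ?_) (fun i => ?_) l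
    · simp
    · simp
  exact this _

lemma countA {N : ℕ} (T F : Finset (Fin N)) (j : ℕ) :
    ((Finset.powersetCard j Tᶜ).filter (fun A => ¬ (F ∩ (T ∪ A)).Nonempty)).card ≤
      (N - T.card - F.card).choose j := by
  by_cases hd : Disjoint F T
  · have hsub : (Finset.powersetCard j Tᶜ).filter (fun A => ¬ (F ∩ (T ∪ A)).Nonempty) ⊆
        Finset.powersetCard j (T ∪ F)ᶜ := by
      intro A hA
      simp only [Finset.mem_filter, Finset.mem_powersetCard,
        Finset.not_nonempty_iff_eq_empty] at hA ⊢
      refine ⟨fun x hx => ?_, hA.1.2⟩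
      have h1 := hA.1.1 hx
      simp only [Finset.mem_compl, Finset.mem_union, not_or] at h1 ⊢
      refine ⟨h1, fun hF => ?_⟩
      have : x ∈ F ∩ (T ∪ A) := by simp [hF, hx]
      rw [hA.2] at this
      simp at this
    refine (Finset.card_le_card hsub).trans ?_
    rw [Finset.card_powersetCard, Finset.card_compl, Finset.card_union_of_disjoint hd.symm,
      Fintype.card_fin, Nat.sub_sub]
  · rw [Finset.filter_false_of_mem]
    · simp
    · intro A _ h
      apply h
      obtain ⟨x, h1, h2⟩ := Finset.not_disjoint_iff.1 hd
      exact ⟨x, by simp [h1, h2]⟩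

/-- (Fano-type lower bound.)  In the finite-alphabet sparse
signal model, for any decoder `φ` outputting an `L`-element subset, with average
probability of error `P_e`, for every `j ∈ {1,…,K}`:
`P_e ≥ 1 − (H_b(P_e) + M·I^{(j)}) / Γ_l(L,N,K,j)`, where
`Γ_l(L,N,K,j) = log[C(N−K+j, j)/C(N−K+j−L, j)]` and
`H_b(p) = −p log p − (1−p) log(1−p)`. -/
theorem stmt6 {𝓧 𝓨 : Type} [Fintype 𝓧] [Fintype 𝓨]
    (N M K L : ℕ) (hK : 1 ≤ K) (hL : 1 ≤ L) (hKN : K ≤ N) (hLNK : L ≤ N - K)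
    (Q : 𝓧 → ℝ) (hQ0 : ∀ x, 0 ≤ Q x) (hQ1 : ∑ x, Q x = 1)
    (W : (Fin K → 𝓧) → 𝓨 → ℝ)
    (hW0 : ∀ xs y, 0 ≤ W xs y) (hW1 : ∀ xs, ∑ y, W xs y = 1)
    (hWsym : ∀ (xs : Fin K → 𝓧) (σ : Equiv.Perm (Fin K)), W (xs ∘ σ) = W xs)
    (φ : (Fin M → Fin N → 𝓧) → (Fin M → 𝓨) → Finset (Fin N))
    (hφcard : ∀ X y, (φ X y).card = L)
    (Pe : ℝ)
    (hPe : Pe = ((N.choose K : ℝ))⁻¹ *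
      ∑ S ∈ Finset.powersetCard K (Finset.univ : Finset (Fin N)),
        ∑ X : Fin M → Fin N → 𝓧, ∑ y : Fin M → 𝓨,
          inputProb N M Q X * lik N M K W X y S *
            (if (φ X y ∩ S).Nonempty then 1 else 0)) :
    ∀ j : ℕ, ∀ hj1 : 1 ≤ j, ∀ hjK : j ≤ K,
      Pe ≥ 1 -
        ((-(Pe * Real.log Pe) - (1 - Pe) * Real.log (1 - Pe)) +
            (M : ℝ) * MIj K j hjK Q W) /
          Real.log (((N - K + j).choose j : ℝ) /
            ((N - K + j - L).choose j : ℝ)) := by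
  classical
  intro j hj1 hjK
  have hN : 0 < N := by omega
  obtain ⟨en1, hen1⟩ := existsEnum hN j
  obtain ⟨en2, hen2⟩ := existsEnum hN (K - j)
  set pairs := (Finset.powersetCard (K - j) (Finset.univ : Finset (Fin N))).sigma
      (fun T => Finset.powersetCard j Tᶜ) with hpairs
  have hmem : ∀ q ∈ pairs, q.1.card = K - j ∧ q.2.card = j ∧ Disjoint q.1 q.2 := by
    intro q hq
    simp only [hpairs, Finset.mem_sigma, Finset.mem_powersetCard, Finset.subset_univ,
      true_and] at hq
    exact ⟨hq.1, hq.2.2, Finset.subset_compl_iff_disjoint_left.1 hq.2.1⟩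
  have hinj : ∀ q ∈ pairs, Function.Injective (Sum.elim (en1 q.2) (en2 q.1)) := by
    intro q hq
    obtain ⟨h1, h2, h3⟩ := hmem q hq
    refine (hen1 _ h2).1.sumElim (hen2 _ h1).1 (fun a b hab => ?_)
    exact Finset.disjoint_left.1 h3 ((hen2 _ h1).2 b) (hab ▸ (hen1 _ h2).2 a)
  have hc1 : (pairs.card : ℝ) = K.choose j * N.choose K := by
    have := sumPairs (N := N) hjK (fun _ => 1)
    rw [Finset.sum_const, Finset.sum_const, Finset.card_powersetCard, Finset.card_univ,
      Fintype.card_fin, nsmul_eq_mul, nsmul_eq_mul, mul_one, mul_one] at this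
    exact this
  have hTc : ∀ T ∈ Finset.powersetCard (K - j) (Finset.univ : Finset (Fin N)),
      T.card = K - j := fun T hT => (Finset.mem_powersetCard.1 hT).2
  have hc2 : (pairs.card : ℝ) = N.choose (K - j) * (N - K + j).choose j := by
    rw [hpairs, Finset.card_sigma, Finset.sum_congr rfl (g := fun _ => (N - K + j).choose j)]
    · simp
    · intro T hT
      rw [Finset.card_powersetCard, Finset.card_compl, hTc T hT, Fintype.card_fin]
      congr 1; omega
  have hKj : (0 : ℝ) < K.choose j := by exact_mod_cast Nat.choose_pos hjK
  have hNK : (0 : ℝ) < N.choose K := by exact_mod_cast Nat.choose_pos hKN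
  have hB : (0 : ℝ) < (N - K + j - L).choose j := by exact_mod_cast Nat.choose_pos (by omega)
  have hAB : ((N - K + j - L).choose j : ℝ) < (N - K + j).choose j := by
    exact_mod_cast chooseLt _ _ _ hL hj1 (by omega)
  have hcpos : (0 : ℝ) < pairs.card := by rw [hc1]; positivity
  set w : ℝ := (pairs.card : ℝ)⁻¹ with hw
  have hwpos : 0 < w := inv_pos.2 hcpos
  set G : ℝ := ((N - K + j).choose j : ℝ) / ((N - K + j - L).choose j : ℝ) with hG
  have hG1 : 1 < G := (one_lt_div hB).2 hAB
  let Z := Fin M → (Fin N → 𝓧) × 𝓨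
  let F : Z → Finset (Fin N) := fun z => φ (fun m => (z m).1) (fun m => (z m).2)
  let pq : (Σ _ : Finset (Fin N), Finset (Fin N)) → Z → ℝ :=
    fun q z => ∏ m, pS K j hjK Q W (en1 q.2) (en2 q.1) (z m)
  let rq : Finset (Fin N) → Z → ℝ := fun T z => ∏ m, rS K j hjK Q W (en2 T) (z m)
  have hrq0 : ∀ T z, 0 ≤ rq T z := fun T z =>
    Finset.prod_nonneg fun m _ => rS_nonneg K j hjK Q hQ0 W hW0 _ _
  have hrq1 : ∀ T, ∑ z, rq T z = 1 := fun T =>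
    sumProdOne _ (rS_sum K j hjK Q hQ1 W hW1 _)
  have hpq1 : ∀ q, ∑ z, pq q z = 1 := fun q =>
    sumProdOne _ (pS_sum K j hjK Q hQ1 W hW1 _ _)
  let P : (Σ _ : Finset (Fin N), Finset (Fin N)) × Z → ℝ := fun i => w * pq i.1 i.2
  let R : (Σ _ : Finset (Fin N), Finset (Fin N)) × Z → ℝ := fun i => w * rq i.1.1 i.2
  let E : (Σ _ : Finset (Fin N), Finset (Fin N)) × Z → Prop :=
    fun i => ¬ (F i.2 ∩ (i.1.1 ∪ i.1.2)).Nonempty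
  have hwc : (pairs.card : ℝ) * w = 1 := mul_inv_cancel₀ hcpos.ne'
  have hP1 : ∑ i ∈ pairs ×ˢ (Finset.univ : Finset Z), P i = 1 := by
    rw [Finset.sum_product]
    simp only [P, ← Finset.mul_sum, hpq1]
    simpa [mul_comm] using hwc
  have hR1 : ∑ i ∈ pairs ×ˢ (Finset.univ : Finset Z), R i = 1 := by
    rw [Finset.sum_product]
    simp only [R, ← Finset.mul_sum, hrq1]
    simpa [mul_comm] using hwc
  -- error probability
  let err : Finset (Fin N) → ℝ := fun S => ∑ z : Z,
    inputProb N M Q (fun m => (z m).1) * lik N M K W (fun m => (z m).1) (fun m => (z m).2) S *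
      (if (F z ∩ S).Nonempty then 1 else 0)
  have hPe2 : Pe = (N.choose K : ℝ)⁻¹ *
      ∑ S ∈ Finset.powersetCard K (Finset.univ : Finset (Fin N)), err S := by
    rw [hPe]
    congr 1
    refine Finset.sum_congr rfl fun S _ => ?_
    rw [← Fintype.sum_prod_type', ← (Equiv.arrowProdEquivProdArrow _ _ _).sum_comp]
    rfl
  have hPE : ∑ i ∈ pairs ×ˢ (Finset.univ : Finset Z) with ¬ E i, P i = Pe := by
    rw [Finset.sum_filter, Finset.sum_product]
    have h1 : ∀ q ∈ pairs, (∑ z : Z, if ¬ E (q, z) then P (q, z) else 0) =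
        w * err (q.1 ∪ q.2) := by
      intro q hq
      obtain ⟨h1, h2, h3⟩ := hmem q hq
      simp only [err]
      rw [Finset.mul_sum]
      refine Finset.sum_congr rfl fun z _ => ?_
      rw [prod_pS N M K j hjK Q W hWsym (en1 q.2) (en2 q.1) q.1 q.2 h1 h2 h3 (hinj q hq)
        (hen1 _ h2).2 (hen2 _ h1).2 z]
      simp only [E, P, pq, not_not]
      split_ifs <;> simp
    rw [Finset.sum_congr rfl h1, ← Finset.mul_sum, hpairs, sumPairs hjK err, hPe2, hw, hc1]
    field_simp
  have hPE' : ∑ i ∈ pairs ×ˢ (Finset.univ : Finset Z) with E i, P i = 1 - Pe := by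
    have := Finset.sum_filter_add_sum_filter_not (pairs ×ˢ (Finset.univ : Finset Z)) E P
    linarith
  have hRE : G * ∑ i ∈ pairs ×ˢ (Finset.univ : Finset Z) with E i, R i ≤ 1 := by
    have h1 : ∑ i ∈ pairs ×ˢ (Finset.univ : Finset Z) with E i, R i ≤
        ∑ T ∈ Finset.powersetCard (K - j) (Finset.univ : Finset (Fin N)),
          w * ((N - K + j - L).choose j : ℝ) := by
      rw [Finset.sum_filter, Finset.sum_product, hpairs, Finset.sum_sigma]
      refine Finset.sum_le_sum fun T hT => ?_
      rw [Finset.sum_comm]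
      have h2 : ∀ z : Z, (∑ A ∈ Finset.powersetCard j Tᶜ,
          if E (⟨T, A⟩, z) then R (⟨T, A⟩, z) else 0) ≤
          w * ((N - K + j - L).choose j : ℝ) * rq T z := by
        intro z
        rw [← Finset.sum_filter]
        simp only [R, E]
        rw [Finset.sum_const, nsmul_eq_mul]
        have h3 := countA T (F z) j
        rw [hTc T hT, show (F z).card = L from hφcard _ _,
          show N - (K - j) - L = N - K + j - L by omega] at h3
        have h4 : ((((Finset.powersetCard j Tᶜ).filter
          (fun A => ¬ (F z ∩ (T ∪ A)).Nonempty)).card : ℕ) : ℝ) ≤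
            ((N - K + j - L).choose j : ℝ) := by exact_mod_cast h3
        have h5 := mul_le_mul_of_nonneg_right h4 (mul_nonneg hwpos.le (hrq0 T z))
        linarith
      refine (Finset.sum_le_sum fun z _ => h2 z).trans ?_
      rw [← Finset.mul_sum, hrq1, mul_one]
    refine (mul_le_mul_of_nonneg_left h1 (by linarith)).trans (le_of_eq ?_)
    rw [Finset.sum_const, Finset.card_powersetCard, Finset.card_univ, Fintype.card_fin,
      nsmul_eq_mul, hG, ← hwc, hc2]
    field_simp
  have hKL : ∑ i ∈ pairs ×ˢ (Finset.univ : Finset Z), P i * Real.log (P i / R i) =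
      M * MIj K j hjK Q W := by
    rw [Finset.sum_product]
    have h1 : ∀ q ∈ pairs, ∑ z : Z, P (q, z) * Real.log (P (q, z) / R (q, z)) =
        w * (M * MIj K j hjK Q W) := by
      intro q hq
      rw [← multi_kl K j hjK Q hQ0 hQ1 W hW0 hW1 _ _ M (hinj q hq), Finset.mul_sum]
      refine Finset.sum_congr rfl fun z _ => ?_
      exact mulLogCancel _ _ _
    rw [Finset.sum_congr rfl h1, Finset.sum_const, nsmul_eq_mul, ← mul_assoc, hwc, one_mul]
  have main := fanoAbs (pairs ×ˢ (Finset.univ : Finset Z)) P R E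
    (fun i _ => mul_nonneg hwpos.le
      (Finset.prod_nonneg fun m _ => pS_nonneg K j hjK Q hQ0 W hW0 _ _ _))
    (fun i _ => mul_nonneg hwpos.le (hrq0 _ _))
    (fun i _ h => by
      rcases mul_eq_zero.1 h with h | h
      · exact absurd h hwpos.ne'
      · obtain ⟨m, hm, h0⟩ := Finset.prod_eq_zero_iff.1 h
        exact mul_eq_zero_of_right _ (Finset.prod_eq_zero hm
          (pS_ac K j hjK Q hQ0 W hW0 _ _ _ h0)))
    hP1 hR1 (1 - Pe) G (by linarith) hPE' hRE
  rw [hKL, sub_sub_cancel] at main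
  have hlog : 0 < Real.log G := Real.log_pos hG1
  have : 1 - Pe ≤ ((-(Pe * Real.log Pe) - (1 - Pe) * Real.log (1 - Pe)) +
            (M : ℝ) * MIj K j hjK Q W) / Real.log G := by
    rw [le_div_iff₀ hlog]
    linarith
  linarith

end
end

section
/- Consider the finite-alphabet sparse signal model with active set S_1 (|S_1| = K) and the multi-stage decoder. Fix the observations y, fix 1 ≤ j ≤ K, and suppose the decoder makes its first error at some stage i with exactly j active variables in the chosen set: i.e., the chosen K-set S_ω at stage i satisfies |S_1 ∩ S_ω| = j while all earlier stages chose only inactive variables. Write S_{1ω} = S_1 ∩ S_ω, S_{1^cω} = S_ω \ S_1, and fix a partition S_{1ω} = S_{1d} ∪ S_{2d} with |S_{1d}| = 1 and |S_{2d}| = j−1. Then this event implies the event A := ∪_{S_z} A_{S_z}, where the union is over all subsets S_z ⊆ {1,…,N} \ S_1 with |S_z| = L_j := (N−K) − (⌈L/K⌉·K − j), and A_{S_z} is the event that P(y | X_{S_{1^cω}}, X_{S_{2d}}, X_{S_α}) ≥ P(y | X_{S_{1^cω}}, X_{S_{2d}}, X_{S_{1d}}) for every single-element subset S_α ⊆ S_z.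 -/
open Finset

noncomputable section

/-- The indices removed before stage `i` of the multi-stage decoder. -/
def prevUnion {N Nstg : ℕ} (ω : Fin Nstg → Finset (Fin N)) (i : Fin Nstg) :
    Finset (Fin N) :=
  (Finset.univ.filter fun i' => i' < i).biUnion ω

/-- `ω` is a run of the greedy multi-stage decoder on `(X, y)`: at each stage `i`
it picks a `K`-element subset of the remaining items minimizing the likelihood. -/
def greedyRun {𝓧 𝓨 : Type} (N M K Nstg : ℕ) (W : (Fin K → 𝓧) → 𝓨 → ℝ)
    (X : Fin M → Fin N → 𝓧) (y : Fin M → 𝓨)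
    (ω : Fin Nstg → Finset (Fin N)) : Prop :=
  ∀ i : Fin Nstg,
    ω i ⊆ Finset.univ \ prevUnion ω i ∧ (ω i).card = K ∧
      ∀ A ⊆ Finset.univ \ prevUnion ω i, A.card = K →
        lik N M K W X y (ω i) ≤ lik N M K W X y A

/-- (The event inclusion `𝓑 ⊆ 𝓐` in the analysis of the
multi-stage decoder.)  Fix the observations `(X, y)` and the active set `S₁`
(`|S₁| = K`).  If the greedy multi-stage decoder makes its first error at stage
`i₀`, with exactly `j` active variables in the chosen `K`-set `S_ω = ω i₀`, then
— writing `S_{1^cω} = S_ω \ S₁` and fixing a partition `S₁ ∩ S_ω = S_{1d} ∪ S_{2d}`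
with `|S_{1d}| = 1`, `|S_{2d}| = j − 1` — there exists a set `S_z` of
`L_j = (N−K) − (⌈L/K⌉·K − j)` inactive variables such that
`P(y | X_{S_{1^cω}}, X_{S_{2d}}, X_{S_α}) ≥ P(y | X_{S_{1^cω}}, X_{S_{2d}}, X_{S_{1d}})`
for every singleton `S_α ⊆ S_z`. -/
theorem stmt7 {𝓧 𝓨 : Type} [Fintype 𝓧] [Fintype 𝓨]
    (N M K L j : ℕ) (hK : 1 ≤ K) (hL : 1 ≤ L) (hKN : K ≤ N) (hLNK : L ≤ N - K)
    (hj1 : 1 ≤ j) (hjK : j ≤ K)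
    (Q : 𝓧 → ℝ) (hQ0 : ∀ x, 0 ≤ Q x) (hQ1 : ∑ x, Q x = 1)
    (W : (Fin K → 𝓧) → 𝓨 → ℝ)
    (hW0 : ∀ xs y, 0 ≤ W xs y) (hW1 : ∀ xs, ∑ y, W xs y = 1)
    (hWsym : ∀ (xs : Fin K → 𝓧) (σ : Equiv.Perm (Fin K)), W (xs ∘ σ) = W xs)
    (X : Fin M → Fin N → 𝓧) (y : Fin M → 𝓨)
    (S1 : Finset (Fin N)) (hS1 : S1.card = K)
    (Nstg : ℕ) (hNstg : Nstg = (L + K - 1) / K)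
    (ω : Fin Nstg → Finset (Fin N)) (hrun : greedyRun N M K Nstg W X y ω)
    (i0 : Fin Nstg)
    (hfirst : ∀ i : Fin Nstg, i < i0 → ω i ∩ S1 = ∅)
    (herr : (S1 ∩ ω i0).card = j)
    (S1d S2d : Finset (Fin N)) (hS1d : S1d.card = 1) (hS2d : S2d.card = j - 1)
    (hdisj : Disjoint S1d S2d) (hpart : S1d ∪ S2d = S1 ∩ ω i0)
    (Lj : ℕ) (hLj : Lj = (N - K) - (Nstg * K - j)) :
    ∃ Sz ⊆ Finset.univ \ S1, Sz.card = Lj ∧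
      ∀ a ∈ Sz,
        lik N M K W X y (((ω i0 \ S1) ∪ S2d) ∪ S1d) ≤
          lik N M K W X y (((ω i0 \ S1) ∪ S2d) ∪ {a}) := by
  obtain ⟨hsub, hcard, hmin⟩ := hrun i0
  have hω : ((ω i0 \ S1) ∪ S2d) ∪ S1d = ω i0 := by
    rw [Finset.union_assoc, Finset.union_comm S2d S1d, hpart, Finset.inter_comm]
    exact Finset.sdiff_union_inter (ω i0) S1
  have hprev : (prevUnion ω i0).card ≤ i0.val * K := by
    unfold prevUnion
    refine (Finset.card_biUnion_le_card_mul _ _ K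
      (fun i _ => (hrun i).2.1.le)).trans ?_
    have : (Finset.univ.filter fun i' => i' < i0) = Finset.Iio i0 := by
      ext i; simp
    rw [this, Fin.card_Iio]
  have hstg : i0.val * K + K ≤ Nstg * K := by
    have := Nat.mul_le_mul_right K (Nat.succ_le_of_lt i0.isLt)
    rwa [Nat.succ_mul] at this
  have h1 : (ω i0 \ S1).card + j = K := by
    have := Finset.card_sdiff_add_card_inter (ω i0) S1
    rw [Finset.inter_comm, herr, hcard] at this
    exact this
  have hbig : Lj ≤ (((Finset.univ \ S1) \ prevUnion ω i0) \ (ω i0 \ S1)).card := by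
    have a1 := Finset.le_card_sdiff (ω i0 \ S1) ((Finset.univ \ S1) \ prevUnion ω i0)
    have a2 := Finset.le_card_sdiff (prevUnion ω i0) (Finset.univ \ S1)
    have a3 := Finset.le_card_sdiff S1 (Finset.univ : Finset (Fin N))
    rw [Finset.card_univ, Fintype.card_fin] at a3
    omega
  obtain ⟨Sz, hSz, hSzc⟩ := Finset.exists_subset_card_eq hbig
  refine ⟨Sz, fun a ha => ?_, hSzc, fun a ha => ?_⟩
  · have := hSz ha
    simp only [Finset.mem_sdiff] at this ⊢
    exact this.1.1
  · have haz := hSz ha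
    simp only [Finset.mem_sdiff, Finset.mem_univ, true_and] at haz
    obtain ⟨⟨haS, hap⟩, haω⟩ := haz
    have hS2 : S2d ⊆ S1 ∩ ω i0 := hpart ▸ Finset.subset_union_right
    rw [hω]
    apply hmin
    · intro b hb
      simp only [Finset.mem_union, Finset.mem_singleton] at hb
      rcases hb with (hb | hb) | hb
      · exact hsub (Finset.mem_sdiff.1 hb).1
      · exact hsub (Finset.mem_inter.1 (hS2 hb)).2
      · subst hb
        simp [hap]
    · rw [Finset.card_union_of_disjoint, Finset.card_union_of_disjoint,
        Finset.card_singleton, hS2d]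
      · omega
      · rw [Finset.disjoint_left]
        intro b hb hb2
        exact (Finset.mem_sdiff.1 hb).2 (Finset.mem_inter.1 (hS2 hb2)).1
      · rw [Finset.disjoint_singleton_right, Finset.mem_union]
        rintro (h | h)
        · exact haω (by simpa using h)
        · exact haS (Finset.mem_inter.1 (hS2 h)).1

end
end

section
/- Let N, K, L be positive integers with K ≥ 2, L an integer multiple of K, L ≥ K, N − K > 4, and 2 ≤ L − 1 ≤ (N−K) − 2. Set α = (L−1)/(N−K), N_b = (N−K)/(K−1), L_j = (N−K) − (L−j) for 1 ≤ j ≤ K, C_2(L,N,K,j) = C(N−K, L_j)·C(K·(L/K) − j, K−j)·C(K,1)·C(K−1, j−1), and Γ_u2 = max_{1 ≤ j ≤ K} log C_2(L,N,K,j) / L_j. Then Γ_u2 ≤ H_b(α)/(1−α) + (1/(1−α))·[ log(e·α·N_b)/N_b + log(K·e^K)/(N−K) ], where H_b(α) = −α log α − (1−α) log(1−α). -/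
open Finset

lemma log_choose_bound (a b : ℕ) (x : ℝ) (h0 : 0 < x) (h1 : x < 1) :
    Real.log ((a+b).choose a : ℝ) ≤ -(a * Real.log x) - b * Real.log (1-x) := by
  have hy : 0 < 1 - x := by linarith
  have hc : (0:ℝ) < ((a+b).choose a : ℝ) := by
    exact_mod_cast Nat.choose_pos (by omega)
  have key : x^a * (1-x)^b * ((a+b).choose a : ℝ) ≤ 1 := by
    have h := add_pow x (1-x) (a+b)
    rw [show x + (1-x) = 1 by ring, one_pow] at h
    have := Finset.single_le_sum (s := Finset.range (a+b+1))
      (f := fun m => x ^ m * (1-x) ^ (a+b - m) * ((a+b).choose m : ℝ))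
      (fun i _ => by positivity) (Finset.mem_range.2 (show a < a+b+1 by omega))
    refine le_trans ?_ h.symm.le
    simpa using this
  have h2 := Real.log_nonpos (by positivity) key
  rw [Real.log_mul (by positivity) (by positivity), Real.log_mul (by positivity) (by positivity),
    Real.log_pow, Real.log_pow] at h2
  linarith

lemma choose_sub_le (m n i : ℕ) (hi : i ≤ n) (hn : n ≤ m) :
    (m - i).choose (n - i) ≤ m.choose n := by
  obtain ⟨p, rfl⟩ := Nat.exists_eq_add_of_le hi
  obtain ⟨q, rfl⟩ := Nat.exists_eq_add_of_le hn
  have e1 : i + p + q - i = p + q := by omega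
  have e2 : i + p - i = p := by omega
  rw [e1, e2]
  rw [← Nat.choose_symm_of_eq_add (show p + q = q + p by omega),
    ← Nat.choose_symm_of_eq_add (show i + p + q = q + (i + p) by omega)]
  exact Nat.choose_le_choose _ (by omega)

lemma log_choose_le (m n : ℕ) (hn1 : 1 ≤ n) (hn : n ≤ m) :
    Real.log (m.choose n : ℝ) ≤ n * Real.log (Real.exp 1 * (m / n)) := by
  have hnp : (0:ℝ) < n := by exact_mod_cast hn1
  have hmp : (0:ℝ) < m := by exact_mod_cast (by omega : 0 < m)
  have hc : (0:ℝ) < (m.choose n : ℝ) := by exact_mod_cast Nat.choose_pos hn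
  rw [← Real.log_pow]
  apply Real.log_le_log hc
  have h1 : (m.choose n : ℝ) ≤ (m:ℝ)^n / (n.factorial : ℝ) := Nat.choose_le_pow_div n m
  have h2 := Real.pow_div_factorial_le_exp (n:ℝ) hnp.le n
  have hf : (0:ℝ) < n.factorial := by exact_mod_cast n.factorial_pos
  refine h1.trans ?_
  rw [mul_pow, div_pow, ← Real.exp_nat_mul, mul_one]
  calc (m:ℝ)^n / (n.factorial : ℝ) = ((n:ℝ)^n / n.factorial) * (m^n / n^n) := by field_simp
    _ ≤ _ := by gcongr

lemma core (m d n i : ℕ) (hd : 0 < d) (hn1 : 1 ≤ n) (hn : n ≤ m) (hi : i ≤ n) (α : ℝ)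
    (hα : α = (m:ℝ) / ((m:ℝ) + d)) :
    Real.log (((m+d).choose (d+i) * (m-i).choose (n-i) * (n+1) * n.choose i : ℕ) : ℝ)
      / ((d + i : ℕ) : ℝ) ≤
    ((m + d) * (-(α * Real.log α) - (1 - α) * Real.log (1 - α)) +
      n * Real.log (Real.exp 1 * (m / n)) + Real.log (n+1) + (n+1)) / d := by
  have hdp : (0:ℝ) < d := by exact_mod_cast hd
  have hnp : (0:ℝ) < n := by exact_mod_cast hn1
  have hmp : (0:ℝ) < m := by exact_mod_cast (by omega : 0 < m)
  have hα0 : 0 < α := by rw [hα]; positivity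
  have h1α : 1 - α = d / ((m:ℝ)+d) := by rw [hα]; field_simp; ring
  have h1α0 : 0 < 1 - α := by rw [h1α]; positivity
  have A := log_choose_bound (d+i) (m-i) (1-α) h1α0 (by linarith)
  rw [show d + i + (m - i) = m + d by omega, Nat.cast_sub (by omega : i ≤ m),
    sub_sub_cancel] at A
  push_cast at A
  have p1 : (0:ℝ) < ((m+d).choose (d+i) : ℝ) := by exact_mod_cast Nat.choose_pos (by omega)
  have p2 : (0:ℝ) < ((m-i).choose (n-i) : ℝ) := by exact_mod_cast Nat.choose_pos (by omega)
  have p3 : (0:ℝ) < (n.choose i : ℝ) := by exact_mod_cast Nat.choose_pos hi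
  have B : Real.log ((m-i).choose (n-i) : ℝ) ≤ n * Real.log (Real.exp 1 * (m / n)) :=
    (Real.log_le_log p2 (by exact_mod_cast choose_sub_le m n i hi hn)).trans
      (log_choose_le m n hn1 hn)
  have C : Real.log (n.choose i : ℝ) ≤ n := by
    have : (n.choose i : ℝ) ≤ 2^n := by
      exact_mod_cast Nat.choose_le_two_pow n i
    have h := Real.log_le_log p3 this
    rw [Real.log_pow] at h
    have : Real.log 2 ≤ 1 := by linarith [Real.log_two_lt_d9]
    nlinarith
  have lα : Real.log α ≤ 0 := Real.log_nonpos hα0.le (by linarith)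
  have lα1 : Real.log (1-α) ≤ 0 := Real.log_nonpos h1α0.le (by linarith)
  have hK : 0 ≤ Real.log ((n:ℝ)+1) := Real.log_nonneg (by linarith)
  have hT : 0 ≤ n * Real.log (Real.exp 1 * (m / n)) := by
    refine le_trans ?_ (log_choose_le m n hn1 hn)
    exact Real.log_nonneg (by exact_mod_cast Nat.choose_pos hn)
  have hH : (m + d) * (-(α * Real.log α) - (1 - α) * Real.log (1 - α)) =
      -(m * Real.log α) - d * Real.log (1-α) := by
    rw [h1α]
    generalize Real.log (d / ((m:ℝ)+d)) = y
    generalize Real.log α = z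
    rw [hα]; field_simp
  rw [hH]
  have hi0 : (0:ℝ) ≤ i := Nat.cast_nonneg i
  push_cast
  rw [Real.log_mul (by positivity) (by positivity), Real.log_mul (by positivity) (by positivity),
    Real.log_mul (by positivity) (by positivity), div_le_div_iff₀ (by positivity) hdp]
  generalize Real.log α = u at *
  generalize Real.log (1-α) = v at *
  generalize n * Real.log (Real.exp 1 * (m / n)) = T at *
  generalize Real.log ((n:ℝ)+1) = k at *
  have S : Real.log ((m+d).choose (d+i) : ℝ) + Real.log ((m-i).choose (n-i) : ℝ) + k +
      Real.log (n.choose i : ℝ) ≤ -((d+i) * v) - (m - i) * u + T + k + n := by linarith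
  have S2 := mul_le_mul_of_nonneg_right S hdp.le
  have q1 : 0 ≤ i * (T + k + n) := by positivity
  have q2 : 0 ≤ -u * (m * i) := mul_nonneg (by linarith) (by positivity)
  have q3 : 0 ≤ -u * (d * i) := mul_nonneg (by linarith) (by positivity)
  have q4 : (0:ℝ) ≤ d + i := by positivity
  nlinarith



/-- Asymptotic upper bound on `Γ_u2 = max_{1 ≤ j ≤ K} log C₂(L,N,K,j) / L_j`:
under the stated range conditions,
`Γ_u2 ≤ H_b(α)/(1−α) + (1/(1−α))·[log(e·α·N_b)/N_b + log(K·e^K)/(N−K)]`,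
where `α = (L−1)/(N−K)` and `N_b = (N−K)/(K−1)`.  (The bound on the maximum is
stated as a bound for every `1 ≤ j ≤ K`.) -/
theorem stmt9 (N K L : ℕ) (hK : 2 ≤ K) (hKL : K ∣ L) (hLK : K ≤ L)
    (hNK : 4 < N - K) (hL2 : 2 ≤ L - 1) (hLU : L - 1 ≤ (N - K) - 2)
    (α Nb : ℝ) (hα : α = ((L : ℝ) - 1) / ((N : ℝ) - K))
    (hNb : Nb = ((N : ℝ) - K) / ((K : ℝ) - 1))
    (Lj : ℕ → ℕ) (hLj : ∀ j, Lj j = (N - K) - (L - j))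
    (C2 : ℕ → ℕ)
    (hC2 : ∀ j, C2 j = (N - K).choose (Lj j) * (K * (L / K) - j).choose (K - j) *
      K.choose 1 * (K - 1).choose (j - 1)) :
    ∀ j ∈ Finset.Icc 1 K,
      Real.log (C2 j : ℝ) / (Lj j : ℝ) ≤
        (-(α * Real.log α) - (1 - α) * Real.log (1 - α)) / (1 - α) +
          (1 / (1 - α)) *
            (Real.log (Real.exp 1 * α * Nb) / Nb +
              Real.log ((K : ℝ) * Real.exp (K : ℝ)) / ((N : ℝ) - K)) := by
  intro j hj
  rw [Finset.mem_Icc] at hj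
  obtain ⟨hj1, hjK⟩ := hj
  obtain ⟨n, rfl⟩ : ∃ n, K = n + 1 := ⟨K - 1, by omega⟩
  obtain ⟨m, rfl⟩ : ∃ m, L = m + 1 := ⟨L - 1, by omega⟩
  obtain ⟨i, rfl⟩ : ∃ i, j = i + 1 := ⟨j - 1, by omega⟩
  obtain ⟨d, rfl⟩ : ∃ d, N = m + d + (n + 1) := ⟨N - (n+1) - m, by omega⟩
  have hd : 0 < d := by omega
  have hdp : (0:ℝ) < d := by exact_mod_cast hd
  have hnp : (0:ℝ) < n := by exact_mod_cast (by omega : 0 < n)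
  have hmp : (0:ℝ) < m := by exact_mod_cast (by omega : 0 < m)
  have hL : Lj (i+1) = d + i := by rw [hLj]; omega
  have hM : ((m + d + (n+1) : ℕ) : ℝ) - ((n+1 : ℕ) : ℝ) = m + d := by push_cast; ring
  rw [hM] at hα hNb ⊢
  have hα' : α = (m:ℝ) / ((m:ℝ) + d) := by rw [hα]; push_cast; ring
  have hNb' : Nb = ((m:ℝ)+d) / n := by rw [hNb]; push_cast; ring
  have hc := core m d n i hd (by omega) (by omega) (by omega) α hα'
  have h1α : 1 - α = d / ((m:ℝ)+d) := by rw [hα']; field_simp; ring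
  rw [hC2, hL, Nat.mul_div_cancel' hKL, Nat.choose_one_right,
    show m + d + (n+1) - (n+1) = m + d by omega, show m + 1 - (i+1) = m - i by omega,
    show n + 1 - (i+1) = n - i by omega, show n + 1 - 1 = n by omega,
    show i + 1 - 1 = i by omega]
  refine hc.trans (le_of_eq ?_)
  have e1 : Real.exp 1 * α * Nb = Real.exp 1 * (m / n) := by
    rw [hα', hNb']; field_simp
  have e2 : Real.log (((n+1 : ℕ) : ℝ) * Real.exp ((n+1 : ℕ) : ℝ)) =
      Real.log ((n:ℝ)+1) + (n+1) := by
    rw [Real.log_mul (by positivity) (by positivity), Real.log_exp]; push_cast; ring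
  rw [e1, e2, hNb']
  generalize -(α * Real.log α) - (1 - α) * Real.log (1 - α) = H
  rw [h1α]
  field_simp
  ring
end

section
/- For every α ∈ (0,1), H_b(α)/(1−α) ≤ (17/6)·α + (1/4)·[ (1−α)^3 + α^4/(1−α) ], where H_b(α) = −α log α − (1−α) log(1−α) is the binary entropy function with natural logarithm. -/
/-- Lower bound for `log (1 - t ^ 2) + t (log (1 + t) - log (1 - t))` from its power series. -/
lemma aux_series (t : ℝ) (ht : |t| < 1) :
    t ^ 2 + t ^ 4 / 6 ≤ Real.log (1 - t ^ 2) + t * (Real.log (1 + t) - Real.log (1 - t)) := by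
  have hs := (Real.hasSum_log_sub_log_of_abs_lt_one ht).mul_left t
  have ht2 : |t ^ 2| < 1 := by
    rw [abs_pow]
    exact pow_lt_one₀ (abs_nonneg t) ht two_ne_zero
  have hl := (Real.hasSum_pow_div_log_of_abs_lt_one ht2).neg
  have h := hl.add hs
  have key := sum_le_hasSum (Finset.range 2) (fun k _ => ?_) h
  · simp only [Finset.sum_range_succ, Finset.sum_range_zero] at key
    norm_num at key
    linarith
  · have e : -((t ^ 2) ^ (k + 1) / ((k : ℝ) + 1)) + t * (2 * (1 / (2 * (k : ℝ) + 1)) * t ^ (2 * k + 1))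
        = (t ^ 2) ^ (k + 1) * (1 / (((k : ℝ) + 1) * (2 * k + 1))) := by
      have h1 : (k : ℝ) + 1 ≠ 0 := by positivity
      have h2 : 2 * (k : ℝ) + 1 ≠ 0 := by positivity
      have h3 : t * t ^ (2 * k + 1) = (t ^ 2) ^ (k + 1) := by ring
      rw [mul_left_comm, h3]
      field_simp
      ring
    rw [e]
    positivity

/-- For every `α ∈ (0,1)`,
`H_b(α)/(1−α) ≤ (17/6)·α + (1/4)·[(1−α)^3 + α^4/(1−α)]`,
where `H_b(α) = −α log α − (1−α) log (1−α)` (natural logarithm). -/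
theorem stmt11 (α : ℝ) (h0 : 0 < α) (h1 : α < 1) :
    (-(α * Real.log α) - (1 - α) * Real.log (1 - α)) / (1 - α) ≤
      (17 / 6) * α + (1 / 4) * ((1 - α) ^ 3 + α ^ 4 / (1 - α)) := by
  have hb : 0 < 1 - α := by linarith
  have ht : |1 - 2 * α| < 1 := by rw [abs_lt]; constructor <;> linarith
  have h := aux_series (1 - 2 * α) ht
  have e1 : Real.log (1 - (1 - 2 * α)) = Real.log 2 + Real.log α := by
    rw [← Real.log_mul two_ne_zero h0.ne']; congr 1; ring
  have e2 : Real.log (1 + (1 - 2 * α)) = Real.log 2 + Real.log (1 - α) := by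
    rw [← Real.log_mul two_ne_zero hb.ne']; congr 1; ring
  have e3 : Real.log (1 - (1 - 2 * α) ^ 2)
      = Real.log 2 + Real.log α + (Real.log 2 + Real.log (1 - α)) := by
    rw [← Real.log_mul two_ne_zero h0.ne', ← Real.log_mul two_ne_zero hb.ne',
      ← Real.log_mul (by positivity) (by positivity)]
    congr 1; ring
  rw [e1, e2, e3] at h
  have hl := Real.log_two_lt_d9
  have hR : (17 / 6) * α + (1 / 4) * ((1 - α) ^ 3 + α ^ 4 / (1 - α))
      = ((17 / 6) * α * (1 - α) + (1 / 4) * ((1 - α) ^ 4 + α ^ 4)) / (1 - α) := by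
    field_simp
  rw [hR]
  apply div_le_div_of_nonneg_right _ hb.le
  have hq : (17 / 6) * α * (1 - α) + (1 / 4) * ((1 - α) ^ 4 + α ^ 4)
      = 71 / 96 - 25 / 48 * (1 - 2 * α) ^ 2 + (1 - 2 * α) ^ 4 / 32 := by ring
  rw [hq]
  have hsq := sq_nonneg ((1 - 2 * α) ^ 2 - 1 / 11)
  nlinarith [sq_nonneg ((1 - 2 * α) ^ 2)]
end

section
/- In the noiseless non-adaptive group testing model with Bernoulli(p) inputs, 0 < p < 1, and K defective items, the quantity E_0(ρ, 1, n) admits the closed form E_0(ρ, 1, n) = −log[ (1−p)^{K−1}·( (1−p)^{1+ρn} + p^{1+ρn} ) + 1 − (1−p)^{K−1} ] for every ρ ∈ [0,1] and every positive integer n. -/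
open Finset

noncomputable section

/-- The Gallager-type exponent `E₀(ρ, j, n)`. -/
def E0j {𝓧 𝓨 : Type} [Fintype 𝓧] [Fintype 𝓨] (K j : ℕ) (hj : j ≤ K)
    (Q : 𝓧 → ℝ) (W : (Fin K → 𝓧) → 𝓨 → ℝ) (ρ : ℝ) (n : ℕ) : ℝ :=
  -Real.log (∑ y : 𝓨, ∑ xr : Fin (K - j) → 𝓧,
      (∑ xs : Fin j → 𝓧,
          (∏ k, Q (xs k)) * condJ K j hj Q W xs xr y ^ (1 / (1 + ρ * (n : ℝ)))) ^
        (1 + ρ * (n : ℝ)))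

theorem or_aux (K : ℕ) (hK : 1 ≤ K) (xs : Fin 1 → Bool) (xr : Fin (K - 1) → Bool) :
    (∃ k : Fin K, (Fin.append xs xr : Fin (1 + (K - 1)) → Bool)
      (Fin.cast (Nat.add_sub_cancel' hK).symm k) = true) ↔
      (xs 0 = true ∨ ∃ k, xr k = true) := by
  constructor
  · rintro ⟨k, hk⟩
    generalize Fin.cast (Nat.add_sub_cancel' hK).symm k = j at hk
    induction j using Fin.addCases with
    | left i =>
      left
      rw [Fin.append_left] at hk
      rwa [Subsingleton.elim i 0] at hk
    | right i =>
      right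
      rw [Fin.append_right] at hk
      exact ⟨i, hk⟩
  · rintro (h | ⟨k, hk⟩)
    · refine ⟨Fin.cast (Nat.add_sub_cancel' hK) (Fin.castAdd (K - 1) 0), ?_⟩
      have : Fin.cast (Nat.add_sub_cancel' hK).symm
        (Fin.cast (Nat.add_sub_cancel' hK) (Fin.castAdd (K - 1) (0 : Fin 1))) =
          Fin.castAdd (K - 1) 0 := by ext; rfl
      rw [this, Fin.append_left, h]
    · refine ⟨Fin.cast (Nat.add_sub_cancel' hK) (Fin.natAdd 1 k), ?_⟩
      have : Fin.cast (Nat.add_sub_cancel' hK).symm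
        (Fin.cast (Nat.add_sub_cancel' hK) (Fin.natAdd 1 k)) =
          Fin.natAdd 1 k := by ext; rfl
      rw [this, Fin.append_right, hk]

theorem rpow_aux (q c s : ℝ) (hq : 0 ≤ q) (hc : 0 ≤ c) (hs : 0 < s) :
    (q * c ^ (1 / s)) ^ s = c * q ^ s := by
  rw [Real.mul_rpow hq (Real.rpow_nonneg hc _), ← Real.rpow_mul hc,
    one_div_mul_cancel hs.ne', Real.rpow_one, mul_comm]

theorem sum_aux (f : (Fin 1 → Bool) → ℝ) :
    ∑ xs, f xs = f (fun _ => true) + f (fun _ => false) := by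
  rw [← (Equiv.funUnique (Fin 1) Bool).symm.sum_comp f, Fintype.sum_bool]
  rfl

/-- In the noiseless non-adaptive group testing model with
`Bernoulli(p)` inputs, `0 < p < 1`, and `K` defective items (the kernel is the
point mass at the Boolean OR of the `K` active inputs), the Gallager exponent
admits the closed form
`E₀(ρ,1,n) = −log[(1−p)^{K−1}·((1−p)^{1+ρn} + p^{1+ρn}) + 1 − (1−p)^{K−1}]`
for every `ρ ∈ [0,1]` and positive integer `n`. -/
theorem stmt15 (K : ℕ) (hK : 1 ≤ K) (p : ℝ) (hp0 : 0 < p) (hp1 : p < 1)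
    (Q : Bool → ℝ) (hQ : Q = fun b => if b then p else 1 - p)
    (W : (Fin K → Bool) → Bool → ℝ)
    (hW : W = fun xs y => if y = decide (∃ k, xs k = true) then 1 else 0)
    (ρ : ℝ) (hρ0 : 0 ≤ ρ) (hρ1 : ρ ≤ 1) (n : ℕ) (hn : 0 < n) :
    E0j K 1 hK Q W ρ n =
      -Real.log ((1 - p) ^ (K - 1) *
          ((1 - p) ^ (1 + ρ * (n : ℝ)) + p ^ (1 + ρ * (n : ℝ))) +
        1 - (1 - p) ^ (K - 1)) := by
  have hs : 0 < 1 + ρ * (n : ℝ) := by positivity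
  unfold E0j
  generalize 1 + ρ * (n : ℝ) = s at hs ⊢
  have hq : 0 < 1 - p := by linarith
  have hQ0 : ∀ b, 0 ≤ Q b := by
    intro b; subst hQ; cases b <;> simp <;> linarith
  have hQt : Q true = p := by subst hQ; simp
  have hQf : Q false = 1 - p := by subst hQ; simp
  congr 2
  rw [Finset.sum_comm]
  have key : ∀ xr : Fin (K - 1) → Bool,
      (∑ y : Bool, (∑ xs : Fin 1 → Bool,
          (∏ k, Q (xs k)) * condJ K 1 hK Q W xs xr y ^ (1 / s)) ^ s) =
      (∏ k, Q (xr k)) + (if xr = fun _ => false then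
        (1 - p) ^ (K - 1) * ((1 - p) ^ s + p ^ s - 1) else 0) := by
    intro xr
    have hc : 0 ≤ ∏ k, Q (xr k) := Finset.prod_nonneg fun k _ => hQ0 _
    have hz : (0 : ℝ) ^ (1 / s) = 0 := Real.zero_rpow (by positivity)
    have hz' : (0 : ℝ) ^ s = 0 := Real.zero_rpow hs.ne'
    have hcond : ∀ xs y, condJ K 1 hK Q W xs xr y =
        if y = decide (xs 0 = true ∨ ∃ k, xr k = true) then ∏ k, Q (xr k) else 0 := by
      intro xs y
      unfold condJ
      rw [hW]
      simp only [or_aux K hK xs xr, mul_ite, mul_one, mul_zero]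
    simp only [hcond, sum_aux, Fintype.sum_bool, Finset.univ_unique, Finset.prod_singleton,
      hQt, hQf]
    by_cases h : ∃ k, xr k = true
    · have hne : xr ≠ fun _ => false := by
        rintro rfl; simp at h
      simp only [h, hne, or_true, decide_true, if_true, if_false, hz, mul_zero, add_zero,
        Bool.false_eq_true, hz', ← add_mul, add_sub_cancel]
      rw [rpow_aux _ _ _ (by linarith) hc hs, Real.one_rpow, mul_one]
    · have he : xr = fun _ => false := by
        funext k; by_contra hk; exact h ⟨k, by simpa using hk⟩
      have hc' : ∏ k, Q (xr k) = (1 - p) ^ (K - 1) := by simp [he, hQf]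
      simp only [h, or_false, decide_true, if_true, hz, mul_zero, add_zero, zero_add,
        Bool.false_eq_true, decide_false, Bool.true_eq_false, if_false]
      rw [rpow_aux _ _ _ hp0.le hc hs, rpow_aux _ _ _ hq.le hc hs, hc', if_pos he]
      ring
  rw [Finset.sum_congr rfl fun xr _ => key xr, Finset.sum_add_distrib,
    Finset.sum_ite_eq' ]
  have h1 : ∑ xr : Fin (K - 1) → Bool, ∏ k, Q (xr k) = 1 := by
    rw [← Fintype.piFinset_univ, ← Finset.prod_univ_sum]
    simp [hQt, hQf]
  rw [h1, if_pos (Finset.mem_univ _)]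
  ring

end
end
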